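/- arXiv:2004.05969 — 7 statements merged into one kernel-verified Lean document; each statement's English description precedes it below -/
import Mathlib

section
/- For every ℓ ∈ {1,…,n}, the union of the SC first-error events up to ℓ equals the union of the genie bit-error events up to ℓ: ⋃_{i=1}^{ℓ} B_i^SC = ⋃_{i=1}^{ℓ} B_i^GA. -/
/-- The genie bit-error event `B_i^GA`: pairs `(u, y) ∈ T` with `i ∈ A` (for `i ∉ A` the
event is empty) such that the decision `f_i(y, u_1^{i-1})` from the true prefix differs
from `u_i`. -/
def BGA {X Y : Type} (n : ℕ) (A : Finset (Fin n))
    (f : (i : Fin n) → (Fin n → Y) → (Fin (i : ℕ) → Option X) → Option X)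
    (T : Set ((Fin n → X) × (Fin n → Y))) (i : Fin n) :
    Set ((Fin n → X) × (Fin n → Y)) :=
  {p | p ∈ T ∧ i ∈ A ∧
    f i p.2 (fun j => some (p.1 ⟨j.1, j.2.trans i.2⟩)) ≠ some (p.1 i)}

/-- The SC first-error event `B_i^SC`: pairs `(u, y) ∈ T` with `i ∈ A` (for `i ∉ A` the
event is empty) such that the SC trajectory is still correct before stage `i`,
`û_1^{i-1}(u,y) = u_1^{i-1}`, and the decision `f_i(y, u_1^{i-1})` differs from `u_i`. -/
def BSC {X Y : Type} (n : ℕ) (A : Finset (Fin n))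
    (f : (i : Fin n) → (Fin n → Y) → (Fin (i : ℕ) → Option X) → Option X)
    (T : Set ((Fin n → X) × (Fin n → Y)))
    (uhat : (Fin n → X) → (Fin n → Y) → Fin n → Option X) (i : Fin n) :
    Set ((Fin n → X) × (Fin n → Y)) :=
  {p | p ∈ T ∧ i ∈ A ∧
    (∀ j : Fin n, (j : ℕ) < (i : ℕ) → uhat p.1 p.2 j = some (p.1 j)) ∧
    f i p.2 (fun j => some (p.1 ⟨j.1, j.2.trans i.2⟩)) ≠ some (p.1 i)}

/-- If the SC output is wrong at stage `i`, then a first error occurred at some stage `k ≤ i`. -/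
lemma exists_mem_BSC_of_uhat_ne {X Y : Type} {n : ℕ} {A : Finset (Fin n)}
    {f : (i : Fin n) → (Fin n → Y) → (Fin (i : ℕ) → Option X) → Option X}
    {T : Set ((Fin n → X) × (Fin n → Y))}
    {uhat : (Fin n → X) → (Fin n → Y) → Fin n → Option X}
    (huhat : ∀ (u : Fin n → X) (y : Fin n → Y) (i : Fin n),
      uhat u y i =
        if i ∈ A then f i y (fun j => uhat u y ⟨j.1, j.2.trans i.2⟩) else some (u i))
    {p : (Fin n → X) × (Fin n → Y)} (hp : p ∈ T) (i : Fin n)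
    (hi : uhat p.1 p.2 i ≠ some (p.1 i)) :
    ∃ k ≤ i, p ∈ BSC n A f T uhat k := by
  induction i using WellFoundedLT.induction with
  | ind i ih =>
    by_cases hprefix : ∀ j : Fin n, (j : ℕ) < (i : ℕ) → uhat p.1 p.2 j = some (p.1 j)
    · have hiA : i ∈ A := by
        by_contra hiA
        exact hi (by rw [huhat, if_neg hiA])
      refine ⟨i, le_rfl, hp, hiA, hprefix, ?_⟩
      have hdecision : (fun j : Fin (i : ℕ) => uhat p.1 p.2 ⟨j.1, j.2.trans i.2⟩) =
          fun j => some (p.1 ⟨j.1, j.2.trans i.2⟩) :=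
        funext fun j => hprefix _ j.2
      rwa [huhat, if_pos hiA, hdecision] at hi
    · push Not at hprefix
      obtain ⟨j, hji, hj⟩ := hprefix
      obtain ⟨k, hkj, hk⟩ := ih j hji hj
      exact ⟨k, hkj.trans (le_of_lt hji), hk⟩

/-- For every `ℓ ∈ {1,…,n}`, the union of the SC first-error events up to
stage `ℓ` equals the union of the genie bit-error events up to stage `ℓ`. -/
theorem union_first_error_eq_union_genie_error {X Y : Type} (n : ℕ) (hn : 0 < n)
    (A : Finset (Fin n))
    (f : (i : Fin n) → (Fin n → Y) → (Fin (i : ℕ) → Option X) → Option X)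
    (T : Set ((Fin n → X) × (Fin n → Y)))
    (uhat : (Fin n → X) → (Fin n → Y) → Fin n → Option X)
    (huhat : ∀ (u : Fin n → X) (y : Fin n → Y) (i : Fin n),
      uhat u y i =
        if i ∈ A then f i y (fun j => uhat u y ⟨j.1, j.2.trans i.2⟩) else some (u i))
    (ℓ : ℕ) (hℓ1 : 1 ≤ ℓ) (hℓn : ℓ ≤ n) :
    (⋃ i : Fin n, ⋃ (_ : (i : ℕ) < ℓ), BSC n A f T uhat i) =
      ⋃ i : Fin n, ⋃ (_ : (i : ℕ) < ℓ), BGA n A f T i := by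
  ext p
  simp only [Set.mem_iUnion, exists_prop]
  constructor
  · rintro ⟨i, hi, hp, hiA, -, herr⟩
    exact ⟨i, hi, hp, hiA, herr⟩
  · rintro ⟨i, hi, hp, hiA, herr⟩
    by_cases hprefix : ∀ j : Fin n, (j : ℕ) < (i : ℕ) → uhat p.1 p.2 j = some (p.1 j)
    · exact ⟨i, hi, hp, hiA, hprefix, herr⟩
    · push Not at hprefix
      obtain ⟨j, hji, hj⟩ := hprefix
      obtain ⟨k, hkj, hk⟩ := exists_mem_BSC_of_uhat_ne huhat hp j hj
      exact ⟨k, lt_of_le_of_lt hkj (hji.trans hi), hk⟩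
end

section
/- (Proposition 1) For any fixed information set A, the block error probability of the SC decoder equals that of the genie-aided SC decoder: for every probability measure P on X^n × Y^n with P(T) = 1, P({(u,y) : û(u,y) ≠ u}) = P({(u,y) : f_i(y, u_1^{i-1}) ≠ u_i for some i ∈ A}). -/
/-- The SC trajectory reproduces `u` iff every decision in `A` made from the true prefix
is correct. -/
theorem sc_output_correct_iff_genie_correct {X Y : Type} {n : ℕ} {A : Finset (Fin n)}
    {f : (i : Fin n) → (Fin n → Y) → (Fin (i : ℕ) → Option X) → Option X}
    {u : Fin n → X} {y : Fin n → Y} {v : Fin n → Option X}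
    (hv : ∀ i : Fin n,
      v i = if i ∈ A then f i y (fun j => v ⟨j.1, j.2.trans i.2⟩) else some (u i)) :
    (∀ i, v i = some (u i)) ↔
      ∀ i ∈ A, f i y (fun j => some (u ⟨j.1, j.2.trans i.2⟩)) = some (u i) := by
  constructor
  · intro h i hi
    simpa only [if_pos hi, h, eq_comm] using hv i
  · intro h i
    induction i using WellFoundedLT.induction with
    | ind i ih =>
      rw [hv i]
      split_ifs with hi
      · rw [← h i hi]
        congr 1
        funext j
        exact ih ⟨j.1, j.2.trans i.2⟩ j.2
      · rfl

/-- **Proposition 1.** For any fixed information set `A`, the block error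
probability of the SC decoder equals that of the genie-aided SC decoder: for every
probability measure `P` on `Xⁿ × Yⁿ` with `P(T) = 1`,
`P(û(u,y) ≠ u) = P(∃ i ∈ A, f_i(y, u_1^{i-1}) ≠ u_i)`. -/
theorem sc_block_error_eq_genie_block_error {X Y : Type}
    [Fintype X] [Fintype Y] [MeasurableSpace X] [MeasurableSpace Y]
    [DiscreteMeasurableSpace X] [DiscreteMeasurableSpace Y] (n : ℕ) (hn : 0 < n)
    (A : Finset (Fin n))
    (f : (i : Fin n) → (Fin n → Y) → (Fin (i : ℕ) → Option X) → Option X)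
    (T : Set ((Fin n → X) × (Fin n → Y)))
    (uhat : (Fin n → X) → (Fin n → Y) → Fin n → Option X)
    (huhat : ∀ (u : Fin n → X) (y : Fin n → Y) (i : Fin n),
      uhat u y i =
        if i ∈ A then f i y (fun j => uhat u y ⟨j.1, j.2.trans i.2⟩) else some (u i))
    (P : MeasureTheory.Measure ((Fin n → X) × (Fin n → Y)))
    [MeasureTheory.IsProbabilityMeasure P] (hT : P T = 1) :
    P {p | ∃ i : Fin n, uhat p.1 p.2 i ≠ some (p.1 i)} =
      P {p | ∃ i ∈ A,
        f i p.2 (fun j => some (p.1 ⟨j.1, j.2.trans i.2⟩)) ≠ some (p.1 i)} := by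
  congr 1
  ext p
  simpa using (sc_output_correct_iff_genie_correct (huhat p.1 p.2)).not
end

section
/- The SC block error probability over the BEC is bounded by the sum of the genie-aided bit-channel erasure probabilities of the information positions: Pr[û(U,Y) ≠ U] ≤ Σ_{i∈A} ε_i. -/
open Matrix

def K2 : Matrix (Fin 2) (Fin 2) (ZMod 2) := !![1, 0; 1, 1]

def kronPow : (m : ℕ) → Matrix (Fin (2 ^ m)) (Fin (2 ^ m)) (ZMod 2)
  | 0 => 1
  | m + 1 =>
      Matrix.reindex (finProdFinEquiv.trans (finCongr (by ring)))
        (finProdFinEquiv.trans (finCongr (by ring)))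
        (Matrix.kroneckerMap (· * ·) K2 (kronPow m))

def bitRev : (m : ℕ) → Equiv.Perm (Fin (2 ^ m))
  | 0 => Equiv.refl _
  | m + 1 =>
      ((finCongr (by ring : 2 ^ (m + 1) = 2 ^ m * 2)).trans
        (finProdFinEquiv.symm.trans
          (((Equiv.prodComm (Fin (2 ^ m)) (Fin 2)).trans
            (Equiv.prodCongr (Equiv.refl (Fin 2)) (bitRev m))).trans
              (finProdFinEquiv.trans (finCongr (by ring : 2 * 2 ^ m = 2 ^ (m + 1)))))))

def Gmat (m : ℕ) : Matrix (Fin (2 ^ m)) (Fin (2 ^ m)) (ZMod 2) :=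
  ((bitRev m).toPEquiv.toMatrix : Matrix (Fin (2 ^ m)) (Fin (2 ^ m)) (ZMod 2)) * kronPow m

/-- The set `S(y)` of inputs `v` consistent with the channel output `y` produced by
transmitting `u G_n` and erasing the positions in `E`. -/
def consistSet (m : ℕ) (u : Fin (2 ^ m) → ZMod 2) (E : Finset (Fin (2 ^ m))) :
    Set (Fin (2 ^ m) → ZMod 2) :=
  {v | ∀ j ∉ E, Matrix.vecMul v (Gmat m) j = Matrix.vecMul u (Gmat m) j}

open scoped Classical in
/-- The genie-aided SC decision `f_i(y, w_1^{i-1})`: `some a` if every `v ∈ S(y)` that agrees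
with `w` before position `i` has `v i = a`, and `none` (erasure) otherwise. -/
noncomputable def fdec (m : ℕ) (u : Fin (2 ^ m) → ZMod 2) (E : Finset (Fin (2 ^ m)))
    (i : Fin (2 ^ m)) (w : Fin (2 ^ m) → ZMod 2) : Option (ZMod 2) :=
  if h : ∃ a : ZMod 2, ∀ v ∈ consistSet m u E,
      (∀ j : Fin (2 ^ m), (j : ℕ) < (i : ℕ) → v j = w j) → v i = a
  then some h.choose else none

open scoped Classical in
/-- Probability of an event under i.i.d. uniform information bits on `A` (zero elsewhere)
and an independent erasure set including each position independently with probability `ε`. -/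
noncomputable def becProb (m : ℕ) (ε : ℝ) (A : Finset (Fin (2 ^ m)))
    (ev : (Fin (2 ^ m) → ZMod 2) → Finset (Fin (2 ^ m)) → Prop) : ℝ :=
  ∑ u ∈ Finset.univ.filter (fun u : Fin (2 ^ m) → ZMod 2 => ∀ j ∉ A, u j = 0),
    ∑ E : Finset (Fin (2 ^ m)),
      if ev u E then ε ^ E.card * (1 - ε) ^ (2 ^ m - E.card) / 2 ^ A.card else 0

open scoped Classical in
/-- The SC decoder output `û` (0-based index `i : ℕ`): frozen bits are set to their known
values and information bits are decoded by `f_i` from the previous estimates; if some previous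
estimate is an erasure (so the prefix is not realizable), decoding of `u_i` fails as well. -/
noncomputable def scOut (m : ℕ) (A : Finset (Fin (2 ^ m))) (u : Fin (2 ^ m) → ZMod 2)
    (E : Finset (Fin (2 ^ m))) (i : ℕ) : Option (ZMod 2) :=
  Nat.strongRecOn i (fun i ih =>
    if h : i < 2 ^ m then
      if (⟨i, h⟩ : Fin (2 ^ m)) ∈ A then
        if hw : ∃ w : Fin (2 ^ m) → ZMod 2,
            ∀ j : Fin (2 ^ m), ∀ hj : (j : ℕ) < i, ih j hj = some (w j)
        then fdec m u E ⟨i, h⟩ hw.choose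
        else none
      else some (u ⟨i, h⟩)
    else none)


open scoped Classical in
/-- One step of the SC decoder in terms of its earlier outputs. -/
theorem scOut_eq (m : ℕ) (A : Finset (Fin (2 ^ m))) (u : Fin (2 ^ m) → ZMod 2)
    (E : Finset (Fin (2 ^ m))) (i : ℕ) (h : i < 2 ^ m) :
    scOut m A u E i =
      if (⟨i, h⟩ : Fin (2 ^ m)) ∈ A then
        if hw : ∃ w : Fin (2 ^ m) → ZMod 2,
            ∀ j : Fin (2 ^ m), (j : ℕ) < i → scOut m A u E j = some (w j)
        then fdec m u E ⟨i, h⟩ hw.choose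
        else none
      else some (u ⟨i, h⟩) := by
  rw [scOut, Nat.strongRecOn_eq, dif_pos h]
  rfl

theorem dite_exists_choose_congr {α : Type*} {p q : α → Prop} {_ : Decidable (∃ a, p a)}
    {_ : Decidable (∃ a, q a)} (h : p = q) :
    (if hp : ∃ a, p a then some hp.choose else none) =
      if hq : ∃ a, q a then some hq.choose else none := by
  subst h
  congr

theorem fdec_congr {m : ℕ} {u w w' : Fin (2 ^ m) → ZMod 2} {E : Finset (Fin (2 ^ m))}
    {i : Fin (2 ^ m)} (hw : ∀ j : Fin (2 ^ m), (j : ℕ) < i → w j = w' j) :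
    fdec m u E i w = fdec m u E i w' := by
  have key : (fun a : ZMod 2 => ∀ v ∈ consistSet m u E,
      (∀ j : Fin (2 ^ m), (j : ℕ) < (i : ℕ) → v j = w j) → v i = a) =
      fun a : ZMod 2 => ∀ v ∈ consistSet m u E,
        (∀ j : Fin (2 ^ m), (j : ℕ) < (i : ℕ) → v j = w' j) → v i = a := by
    simp +contextual only [hw]
  exact dite_exists_choose_congr key

/-- The genie-aided decision is never wrong: it is either an erasure or the true bit. -/
theorem fdec_self_eq_some {m : ℕ} {u : Fin (2 ^ m) → ZMod 2} {E : Finset (Fin (2 ^ m))}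
    {i : Fin (2 ^ m)} (h : fdec m u E i u ≠ none) : fdec m u E i u = some (u i) := by
  unfold fdec at h ⊢
  split_ifs at h ⊢ with ha
  · exact congrArg some (ha.choose_spec u (fun _ _ => rfl) fun _ _ => rfl).symm
  · exact absurd rfl h

/-- If no genie-aided decision is an erasure, the SC decoder recovers every bit. -/
theorem scOut_eq_some {m : ℕ} {A : Finset (Fin (2 ^ m))} {u : Fin (2 ^ m) → ZMod 2}
    {E : Finset (Fin (2 ^ m))} (hA : ∀ i ∈ A, fdec m u E i u ≠ none) (i : Fin (2 ^ m)) :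
    scOut m A u E i = some (u i) := by
  obtain ⟨i, hi⟩ := i
  induction i using Nat.strong_induction_on with
  | _ i ih =>
    have hex : ∃ w : Fin (2 ^ m) → ZMod 2,
        ∀ j : Fin (2 ^ m), (j : ℕ) < i → scOut m A u E j = some (w j) :=
      ⟨u, fun j hj => ih j hj j.isLt⟩
    rw [scOut_eq m A u E i hi]
    split_ifs with hiA
    · rw [← fdec_self_eq_some (hA _ hiA)]
      exact fdec_congr fun j hj =>
        Option.some_injective _ ((hex.choose_spec j hj).symm.trans (ih j hj j.isLt))
    · rfl

/-- The union bound for `becProb`. -/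
theorem becProb_le_sum {m : ℕ} {ε : ℝ} (hε0 : 0 ≤ ε) (hε1 : ε ≤ 1)
    (A : Finset (Fin (2 ^ m))) {ι : Type*} (s : Finset ι)
    {ev : (Fin (2 ^ m) → ZMod 2) → Finset (Fin (2 ^ m)) → Prop}
    {ev' : ι → (Fin (2 ^ m) → ZMod 2) → Finset (Fin (2 ^ m)) → Prop}
    (h : ∀ u E, ev u E → ∃ i ∈ s, ev' i u E) :
    becProb m ε A ev ≤ ∑ i ∈ s, becProb m ε A (ev' i) := by
  classical
  unfold becProb
  rw [Finset.sum_comm (s := s)]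
  refine Finset.sum_le_sum fun u _ => ?_
  rw [Finset.sum_comm (s := s)]
  refine Finset.sum_le_sum fun E _ => ?_
  have hp : 0 ≤ ε ^ E.card * (1 - ε) ^ (2 ^ m - E.card) / 2 ^ A.card :=
    div_nonneg (mul_nonneg (pow_nonneg hε0 _) (pow_nonneg (sub_nonneg.2 hε1) _)) (by positivity)
  have hnonneg : ∀ i ∈ s, (0 : ℝ) ≤
      if ev' i u E then ε ^ E.card * (1 - ε) ^ (2 ^ m - E.card) / 2 ^ A.card else 0 :=
    fun i _ => by split_ifs <;> first | exact hp | exact le_rfl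
  split_ifs with hev
  · obtain ⟨i, his, hi⟩ := h u E hev
    refine le_trans ?_ (Finset.single_le_sum hnonneg his)
    rw [if_pos hi]
  · exact Finset.sum_nonneg hnonneg

/-- The SC block error probability over the BEC is bounded by the sum of
the genie-aided bit-channel erasure probabilities of the information positions:
`Pr[û(U,Y) ≠ U] ≤ Σ_{i∈A} ε_i`. -/
theorem sc_block_error_le_sum_erasure_probs (m : ℕ) (hm : 1 ≤ m)
    (ε : ℝ) (hε0 : 0 ≤ ε) (hε1 : ε ≤ 1) (A : Finset (Fin (2 ^ m))) :
    becProb m ε A (fun u E => ∃ i : Fin (2 ^ m), scOut m A u E (i : ℕ) ≠ some (u i)) ≤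
      ∑ i ∈ A, becProb m ε A (fun u E => fdec m u E i u = none) := by
  refine becProb_le_sum hε0 hε1 A A fun u E ⟨i, hi⟩ => ?_
  by_contra! hA
  exact hi (scOut_eq_some hA i)
end

section
/- Let S be a nonempty affine subspace of F_2^n, u ∈ S, and i ∈ {1,…,n}. Then the i-th coordinate is constant on the fiber {v ∈ S : v_j = u_j for all j < i} if and only if there exist a_0 ∈ F_2 and a_1,…,a_{i-1} ∈ F_2 such that v_i = a_0 + Σ_{j=1}^{i-1} a_j v_j for every v ∈ S. (This is the affine-geometric content of Lemma 1: over the BEC, the genie-aided SC decision at stage i is determined if and only if the i-th input bit is an affine function of the earlier input bits on the set of inputs consistent with the channel output.) -/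
/-- If a coordinate vanishes on every vector of `W` whose coordinates satisfying `p` all vanish,
then on `W` it is a linear combination of the coordinates satisfying `p`. -/
theorem Submodule.exists_coord_eq_sum_of_forall_coord_eq_zero {K ι : Type*} [Field K] [Fintype ι]
    (W : Submodule K (ι → K)) (p : ι → Prop) [DecidablePred p] (i : ι)
    (h : ∀ w ∈ W, (∀ j, p j → w j = 0) → w i = 0) :
    ∃ a : ι → K, ∀ w ∈ W, w i = ∑ j ∈ Finset.univ.filter p, a j * w j := by
  let L : ι → W →ₗ[K] K := fun j => if p j then LinearMap.proj j ∘ₗ W.subtype else 0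
  have hL : ∀ j (w : W), L j w = if p j then (w : ι → K) j else 0 := by
    intro j w
    by_cases hj : p j <;> simp [L, hj]
  have hker : ⨅ j, LinearMap.ker (L j) ≤
      LinearMap.ker ((LinearMap.proj i : (ι → K) →ₗ[K] K) ∘ₗ W.subtype) := by
    intro w hw
    simp only [Submodule.mem_iInf, LinearMap.mem_ker, hL] at hw
    exact h w w.2 fun j hj => by simpa [hj] using hw j
  obtain ⟨a, ha⟩ := (Submodule.mem_span_range_iff_exists_fun K).1 (mem_span_of_iInf_ker_le_ker hker)
  refine ⟨a, fun w hw => ?_⟩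
  have key := LinearMap.congr_fun ha ⟨w, hw⟩
  simpa [hL, Finset.sum_filter] using key.symm

/-- Let `S` be a nonempty affine subspace of `F₂ⁿ` (a coset of a linear
subspace), `u ∈ S`, and `i` a coordinate. The `i`-th coordinate is constant on the fiber
`{v ∈ S : v_j = u_j for all j < i}` if and only if there are coefficients `a₀` and
`a₁, …, a_{i-1}` with `v_i = a₀ + Σ_{j<i} a_j v_j` for every `v ∈ S`. -/
theorem coord_constant_on_fiber_iff_affine_function_of_prefix (n : ℕ)
    (S : Set (Fin n → ZMod 2))
    (hS : ∃ (W : Submodule (ZMod 2) (Fin n → ZMod 2)) (x : Fin n → ZMod 2),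
      S = {v | ∃ w ∈ W, v = x + w})
    (u : Fin n → ZMod 2) (hu : u ∈ S) (i : Fin n) :
    (∀ v ∈ S, ∀ v' ∈ S, (∀ j : Fin n, (j : ℕ) < (i : ℕ) → v j = u j) →
        (∀ j : Fin n, (j : ℕ) < (i : ℕ) → v' j = u j) → v i = v' i) ↔
      ∃ (a0 : ZMod 2) (a : Fin n → ZMod 2), ∀ v ∈ S,
        v i = a0 + ∑ j ∈ Finset.univ.filter (fun j : Fin n => (j : ℕ) < (i : ℕ)),
          a j * v j := by
  obtain ⟨W, x, rfl⟩ := hS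
  obtain ⟨w₀, hw₀, rfl⟩ := hu
  constructor
  · intro h
    obtain ⟨a, ha⟩ := W.exists_coord_eq_sum_of_forall_coord_eq_zero
      (fun j : Fin n => (j : ℕ) < (i : ℕ)) i fun w hw hz => by
        simpa using h (x + (w₀ + w)) ⟨_, W.add_mem hw₀ hw, rfl⟩ (x + w₀) ⟨_, hw₀, rfl⟩
          (fun j hj => by simp [hz j hj]) fun _ _ => rfl
    refine ⟨x i - ∑ j ∈ Finset.univ.filter (fun j : Fin n => (j : ℕ) < (i : ℕ)), a j * x j, a, ?_⟩
    rintro _ ⟨w, hw, rfl⟩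
    simp only [Pi.add_apply, mul_add, Finset.sum_add_distrib, ha w hw]
    ring
  · rintro ⟨a0, a, ha⟩ v hv v' hv' hvu hvu'
    rw [ha v hv, ha v' hv']
    congr 1
    refine Finset.sum_congr rfl fun j hj => ?_
    have hji := (Finset.mem_filter.1 hj).2
    rw [hvu j hji, hvu' j hji]
end

section
/- (Lemma 1) For every input u ∈ F_2^n with u_j = 0 for all j ∉ A, every erasure set E with resulting output y, and every stage i ∈ {1,…,n}: the genie-aided SC decision erases, f_i(y, u_1^{i-1}) = e, if and only if there exist NO coefficients a_0 ∈ F_2 and (a_j)_{j∈G_i} ∈ F_2^{G_i} such that v_i = a_0 + Σ_{j∈G_i} a_j v_j for every v ∈ S_i(y). Equivalently, the SC inactivation decoder's decision function produces an erasure (leading to an inactivation when i ∈ A) exactly when the genie-aided SC decoder produces an erasure. -/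
open Matrix

open scoped Classical in
/-- The set `G_i` of indices inactivated before stage `i` (0-based: `inactSet … t` is the
set of inactivations among the first `t` positions). -/
noncomputable def inactSet (m : ℕ) (A : Finset (Fin (2 ^ m))) (u : Fin (2 ^ m) → ZMod 2)
    (E : Finset (Fin (2 ^ m))) : ℕ → Finset (Fin (2 ^ m))
  | 0 => ∅
  | t + 1 =>
      inactSet m A u E t ∪
        if h : t < 2 ^ m then
          (if (⟨t, h⟩ : Fin (2 ^ m)) ∈ A ∧ fdec m u E ⟨t, h⟩ u = none
            then {(⟨t, h⟩ : Fin (2 ^ m))} else ∅)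
        else ∅

/-- The decoder's stage-`i` consistency set `S_i(y)`. -/
def consistStage (m : ℕ) (A : Finset (Fin (2 ^ m))) (u : Fin (2 ^ m) → ZMod 2)
    (E : Finset (Fin (2 ^ m))) (i : Fin (2 ^ m)) : Set (Fin (2 ^ m) → ZMod 2) :=
  {v | (∀ j ∉ E, Matrix.vecMul v (Gmat m) j = Matrix.vecMul u (Gmat m) j) ∧
    ∀ j : Fin (2 ^ m), j ∉ A → (j : ℕ) < (i : ℕ) → v j = 0}

theorem mem_inactSet_iff (m : ℕ) (A : Finset (Fin (2 ^ m))) (u : Fin (2 ^ m) → ZMod 2)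
    (E : Finset (Fin (2 ^ m))) (t : ℕ) (j : Fin (2 ^ m)) :
    j ∈ inactSet m A u E t ↔ (j : ℕ) < t ∧ j ∈ A ∧ fdec m u E j u = none := by
  induction t with
  | zero => simp [inactSet]
  | succ t ih =>
    rw [inactSet, Finset.mem_union, ih, Nat.lt_succ_iff_lt_or_eq, or_and_right]
    refine or_congr_right ?_
    constructor
    · intro h
      split_ifs at h with ht hA
      · obtain rfl := Finset.mem_singleton.mp h
        exact ⟨rfl, hA⟩
      · simp at h
      · simp at h
    · rintro ⟨rfl, hA⟩
      rw [dif_pos j.isLt, if_pos hA]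
      exact Finset.mem_singleton_self j

/-- The differences of two elements of the stage-`i` consistency set. -/
def stageDirection (m : ℕ) (A E : Finset (Fin (2 ^ m))) (i : Fin (2 ^ m)) :
    Submodule (ZMod 2) (Fin (2 ^ m) → ZMod 2) where
  carrier := {w | (∀ j ∉ E, Matrix.vecMul w (Gmat m) j = 0) ∧
    ∀ j : Fin (2 ^ m), j ∉ A → (j : ℕ) < (i : ℕ) → w j = 0}
  zero_mem' := by simp
  add_mem' := by
    rintro v w ⟨hv, hv'⟩ ⟨hw, hw'⟩
    refine ⟨fun j hj => ?_, fun j hj hji => ?_⟩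
    · rw [Matrix.add_vecMul, Pi.add_apply, hv j hj, hw j hj, add_zero]
    · rw [Pi.add_apply, hv' j hj hji, hw' j hj hji, add_zero]
  smul_mem' := by
    rintro c w ⟨hw, hw'⟩
    refine ⟨fun j hj => ?_, fun j hj hji => ?_⟩
    · rw [Matrix.smul_vecMul, Pi.smul_apply, hw j hj, smul_zero]
    · rw [Pi.smul_apply, hw' j hj hji, smul_zero]

theorem sub_mem_stageDirection {m : ℕ} {A E : Finset (Fin (2 ^ m))} {i : Fin (2 ^ m)}
    {u v : Fin (2 ^ m) → ZMod 2} (hu : ∀ j ∉ A, u j = 0)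
    (hv : v ∈ consistStage m A u E i) : v - u ∈ stageDirection m A E i := by
  refine ⟨fun j hj => ?_, fun j hj hji => ?_⟩
  · rw [Matrix.sub_vecMul, Pi.sub_apply, hv.1 j hj, sub_self]
  · rw [Pi.sub_apply, hv.2 j hj hji, hu j hj, sub_zero]

theorem fdec_eq_none_iff (m : ℕ) (u w : Fin (2 ^ m) → ZMod 2) (E : Finset (Fin (2 ^ m)))
    (i : Fin (2 ^ m)) :
    fdec m u E i w = none ↔ ¬ ∃ a : ZMod 2, ∀ v ∈ consistSet m u E,
      (∀ j : Fin (2 ^ m), (j : ℕ) < (i : ℕ) → v j = w j) → v i = a := by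
  unfold fdec
  split_ifs with h
  · exact iff_of_false not_false (not_not.mpr h)
  · exact iff_of_true rfl h

/-- Where the genie-aided decoder does not erase, a direction consistent with the unerased
outputs that vanishes before position `i` also vanishes at `i`. -/
theorem apply_eq_zero_of_fdec_ne_none {m : ℕ} {u w : Fin (2 ^ m) → ZMod 2}
    {E : Finset (Fin (2 ^ m))} {i : Fin (2 ^ m)} (h : fdec m u E i u ≠ none)
    (hw : ∀ j ∉ E, Matrix.vecMul w (Gmat m) j = 0)
    (hlt : ∀ j : Fin (2 ^ m), (j : ℕ) < (i : ℕ) → w j = 0) : w i = 0 := by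
  rw [Ne, fdec_eq_none_iff, not_not] at h
  obtain ⟨a, ha⟩ := h
  have hsum := ha (u + w)
    (fun j hj => by rw [Matrix.add_vecMul, Pi.add_apply, hw j hj, add_zero])
    (fun j hj => by rw [Pi.add_apply, hlt j hj, add_zero])
  have hbase := ha u (fun _ _ => rfl) (fun _ _ => rfl)
  rw [Pi.add_apply, hbase] at hsum
  exact add_eq_left.mp hsum

/-- A stage-`i` direction that vanishes on the inactivated positions vanishes before `i`. -/
theorem eq_zero_of_forall_mem_inactSet {m : ℕ} {A E : Finset (Fin (2 ^ m))}
    {u w : Fin (2 ^ m) → ZMod 2} {i : Fin (2 ^ m)} (hw : w ∈ stageDirection m A E i)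
    (hG : ∀ j ∈ inactSet m A u E i, w j = 0) (j : Fin (2 ^ m)) (hji : (j : ℕ) < (i : ℕ)) :
    w j = 0 := by
  induction j using WellFoundedLT.induction with
  | ind j ih =>
    by_cases hA : j ∈ A
    · by_cases hf : fdec m u E j u = none
      · exact hG j ((mem_inactSet_iff m A u E i j).mpr ⟨hji, hA, hf⟩)
      · exact apply_eq_zero_of_fdec_ne_none hf hw.1 fun k hk => ih k hk (hk.trans hji)
    · exact hw.2 j hA hji

/-- Where the genie-aided decoder does not erase, the `i`-th coordinate of a stage-`i` direction
is a fixed linear combination of its inactivated coordinates. -/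
theorem exists_coeff_of_fdec_ne_none {m : ℕ} {A E : Finset (Fin (2 ^ m))}
    {u : Fin (2 ^ m) → ZMod 2} {i : Fin (2 ^ m)} (h : fdec m u E i u ≠ none) :
    ∃ a : Fin (2 ^ m) → ZMod 2, ∀ w ∈ stageDirection m A E i,
      w i = ∑ j ∈ inactSet m A u E i, a j * w j := by
  let coord (j : Fin (2 ^ m)) : stageDirection m A E i →ₗ[ZMod 2] ZMod 2 :=
    LinearMap.proj j ∘ₗ (stageDirection m A E i).subtype
  have hspan : coord i ∈ Submodule.span (ZMod 2)
      (Set.range fun j : inactSet m A u E i => coord j) := by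
    refine mem_span_of_iInf_ker_le_ker fun w hw => ?_
    simp only [Submodule.mem_iInf, LinearMap.mem_ker] at hw
    exact apply_eq_zero_of_fdec_ne_none h w.2.1
      (eq_zero_of_forall_mem_inactSet w.2 fun j hj => hw ⟨j, hj⟩)
  have himage : (Set.range fun j : inactSet m A u E i => coord j) =
      coord '' (inactSet m A u E i : Set (Fin (2 ^ m))) := by
    ext; simp
  rw [himage, Submodule.mem_span_image_finset_iff_exists_fun'] at hspan
  obtain ⟨a, ha⟩ := hspan
  refine ⟨a, fun w hw => ?_⟩
  simpa [coord] using (LinearMap.congr_fun ha ⟨w, hw⟩).symm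

/-- **Lemma 1.** The genie-aided SC decision at stage `i` erases if and only if
there are no coefficients `a₀` and `(a_j)_{j ∈ G_i}` expressing `v i` as the affine combination
`a₀ + Σ_{j ∈ G_i} a_j v_j` on all of `S_i(y)`; i.e., the SC inactivation decoder's decision
function produces an erasure exactly when the genie-aided SC decoder does. -/
theorem sc_inactivation_erases_iff_genie_erases (m : ℕ) (hm : 1 ≤ m)
    (A : Finset (Fin (2 ^ m))) (u : Fin (2 ^ m) → ZMod 2) (hu : ∀ j ∉ A, u j = 0)
    (E : Finset (Fin (2 ^ m))) (i : Fin (2 ^ m)) :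
    fdec m u E i u = none ↔
      ¬ ∃ (a0 : ZMod 2) (a : Fin (2 ^ m) → ZMod 2),
        ∀ v ∈ consistStage m A u E i,
          v i = a0 + ∑ j ∈ inactSet m A u E (i : ℕ), a j * v j := by
  rw [fdec_eq_none_iff, not_iff_not]
  constructor
  · intro h
    obtain ⟨a, ha⟩ := exists_coeff_of_fdec_ne_none (A := A) (mt (fdec_eq_none_iff m u u E i).mp
      (not_not.mpr h))
    refine ⟨u i - ∑ j ∈ inactSet m A u E i, a j * u j, a, fun v hv => ?_⟩
    have hvu := ha (v - u) (sub_mem_stageDirection hu hv)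
    simp only [Pi.sub_apply, mul_sub, Finset.sum_sub_distrib] at hvu
    linear_combination hvu
  · rintro ⟨a0, a, ha⟩
    refine ⟨a0 + ∑ j ∈ inactSet m A u E i, a j * u j, fun v hv hvu => ?_⟩
    rw [ha v ⟨hv, fun j hj hji => (hvu j hji).trans (hu j hj)⟩]
    congr 1
    refine Finset.sum_congr rfl fun j hj => ?_
    rw [hvu j ((mem_inactSet_iff m A u E i j).mp hj).1]
end

section
/- For every m ≥ 0 and every row index i with 0 ≤ i < 2^m (rows and columns indexed from 0), the Hamming weight (number of nonzero entries) of the i-th row of K_2^{⊗m} over F_2 equals 2^{s(i)}, where s(i) is the number of ones in the binary expansion of i. -/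
open Matrix

/-- The number of ones in the binary expansion is additive when a leading bit is prepended. -/
theorem count_one_digits_add_two_pow_mul (m b : ℕ) (hb : b < 2 ^ m) (a : Fin 2) :
    (Nat.digits 2 (b + 2 ^ m * a)).count 1 = (Nat.digits 2 b).count 1 + a := by
  fin_cases a
  · simp
  · obtain ⟨k, hk⟩ := Nat.exists_eq_add_of_le
      ((Nat.digits_length_le_iff (by norm_num : 1 < 2) b).2 hb)
    have h := Nat.digits_append_zeroes_append_digits (b := 2) (k := k) (n := b) (m := 1)
      (by norm_num) (by norm_num)
    rw [← hk] at h
    change List.count 1 (Nat.digits 2 (b + 2 ^ m * 1)) = _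
    rw [← h]
    simp [List.count_replicate]

/-- The `a`-th row of `K2` has weight `2 ^ a`. -/
theorem K2_row_weight (a : Fin 2) :
    (Finset.univ.filter (fun c : Fin 2 => K2 a c ≠ 0)).card = 2 ^ (a : ℕ) := by
  revert a
  decide

/-- The Hamming weight of a row is multiplicative under the Kronecker product. -/
theorem kroneckerMap_row_weight {R α β γ δ : Type*} [MulZeroClass R] [NoZeroDivisors R]
    [DecidableEq R] [Fintype β] [Fintype δ] (A : Matrix α β R) (B : Matrix γ δ R) (p : α × γ) :
    (Finset.univ.filter (fun q : β × δ => Matrix.kroneckerMap (· * ·) A B p q ≠ 0)).card =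
      (Finset.univ.filter (fun j => A p.1 j ≠ 0)).card *
        (Finset.univ.filter (fun j => B p.2 j ≠ 0)).card := by
  rw [← Finset.card_product]
  congr 1
  ext q
  simp

/-- For every `m ≥ 0` and every row index `i` with `0 ≤ i < 2^m`, the
Hamming weight of the `i`-th row of `K₂^{⊗m}` equals `2^{s(i)}`, where `s(i)` is the number
of ones in the binary expansion of `i`. -/
theorem kronPow_row_weight (m : ℕ) (i : Fin (2 ^ m)) :
    (Finset.univ.filter (fun j : Fin (2 ^ m) => kronPow m i j ≠ 0)).card =
      2 ^ ((Nat.digits 2 (i : ℕ)).count 1) := by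
  induction m with
  | zero =>
    revert i
    simp only [kronPow]
    decide
  | succ m ih =>
    let e : Fin 2 × Fin (2 ^ m) ≃ Fin (2 ^ (m + 1)) :=
      finProdFinEquiv.trans (finCongr (by ring))
    obtain ⟨⟨a, b⟩, rfl⟩ := e.surjective i
    have hval : ((e (a, b) : Fin (2 ^ (m + 1))) : ℕ) = b + 2 ^ m * a := rfl
    have hentry (q : Fin 2 × Fin (2 ^ m)) : kronPow (m + 1) (e (a, b)) (e q) =
        Matrix.kroneckerMap (· * ·) K2 (kronPow m) (a, b) q := by
      change Matrix.reindex e e (Matrix.kroneckerMap (· * ·) K2 (kronPow m)) _ _ = _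
      simp only [Matrix.reindex_apply, Matrix.submatrix_apply, Equiv.symm_apply_apply]
    rw [hval, count_one_digits_add_two_pow_mul m b b.isLt a, pow_add _ (List.count 1 _), ← ih b, ← K2_row_weight a,
      mul_comm, ← kroneckerMap_row_weight K2 (kronPow m) (a, b)]
    refine (Finset.card_equiv e fun q => ?_).symm
    simp only [Finset.mem_filter, Finset.mem_univ, true_and, hentry]
end

section
/- For 0 ≤ r ≤ m, the F_2-span of those rows of K_2^{⊗m} whose Hamming weight is at least 2^{m−r} is a linear subspace of F_2^{2^m} (the Reed–Muller code RM(r,m)) of dimension Σ_{j=0}^{r} binom(m,j); equivalently, the number of indices i with 0 ≤ i < 2^m whose row of K_2^{⊗m} has Hamming weight at least 2^{m−r} equals Σ_{j=0}^{r} binom(m,j), and these rows are linearly independent. -/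
open Matrix

/-- The number of nonzero entries of row `i` of `kronPow m`. -/
def rowWeight (m : ℕ) (i : Fin (2 ^ m)) : ℕ :=
  (Finset.univ.filter (fun j => kronPow m i j ≠ 0)).card

/-- The indexing of rows and columns used in the recursive step of `kronPow`. -/
def kronIndex (m : ℕ) : Fin 2 × Fin (2 ^ m) ≃ Fin (2 ^ (m + 1)) :=
  finProdFinEquiv.trans (finCongr (by ring))

lemma kronPow_succ (m : ℕ) :
    kronPow (m + 1) =
      Matrix.reindex (kronIndex m) (kronIndex m) (Matrix.kroneckerMap (· * ·) K2 (kronPow m)) :=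
  rfl

lemma kronPow_kronIndex (m : ℕ) (a b : Fin 2) (i j : Fin (2 ^ m)) :
    kronPow (m + 1) (kronIndex m (a, i)) (kronIndex m (b, j)) = K2 a b * kronPow m i j := by
  simp [kronPow_succ]

lemma card_filter_kronIndex (m : ℕ) (p : Fin (2 ^ (m + 1)) → Prop) [DecidablePred p] :
    (Finset.univ.filter p).card =
      (Finset.univ.filter fun i => p (kronIndex m (0, i))).card +
        (Finset.univ.filter fun i => p (kronIndex m (1, i))).card := by
  simp only [Finset.card_filter]
  rw [← Equiv.sum_comp (kronIndex m), Fintype.sum_prod_type, Fin.sum_univ_two]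

lemma rowWeight_kronIndex_zero (m : ℕ) (i : Fin (2 ^ m)) :
    rowWeight (m + 1) (kronIndex m (0, i)) = rowWeight m i := by
  rw [rowWeight, card_filter_kronIndex]
  simp [kronPow_kronIndex, K2, rowWeight]

lemma rowWeight_kronIndex_one (m : ℕ) (i : Fin (2 ^ m)) :
    rowWeight (m + 1) (kronIndex m (1, i)) = 2 * rowWeight m i := by
  rw [rowWeight, card_filter_kronIndex]
  simp [kronPow_kronIndex, K2, rowWeight, two_mul]

lemma sum_range_succ_choose_succ (m n : ℕ) :
    ∑ j ∈ Finset.range (n + 1), (m + 1).choose j =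
      ∑ j ∈ Finset.range n, m.choose j + ∑ j ∈ Finset.range (n + 1), m.choose j := by
  rw [Finset.sum_range_succ', Finset.sum_range_succ' (fun j => m.choose j)]
  simp [Nat.choose_succ_succ, Finset.sum_add_distrib, add_assoc]

lemma card_two_pow_le_rowWeight (m t : ℕ) :
    (Finset.univ.filter fun i => 2 ^ t ≤ rowWeight m i).card =
      ∑ j ∈ Finset.range (m + 1 - t), m.choose j := by
  induction m generalizing t with
  | zero =>
    have weight_eq : ∀ i, rowWeight 0 i = 1 := by decide
    cases t with
    | zero => simp [weight_eq]
    | succ t => simp [weight_eq]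
  | succ m ih =>
    rw [card_filter_kronIndex]
    simp only [rowWeight_kronIndex_zero, rowWeight_kronIndex_one]
    cases t with
    | zero =>
      have le_two_mul_iff : ∀ w : ℕ, 2 ^ 0 ≤ 2 * w ↔ 2 ^ 0 ≤ w := by intro w; omega
      simp only [le_two_mul_iff, ih, Nat.sub_zero, Nat.sum_range_choose]
      ring
    | succ t =>
      have le_two_mul_iff : ∀ w : ℕ, 2 ^ (t + 1) ≤ 2 * w ↔ 2 ^ t ≤ w := by
        intro w; rw [pow_succ]; omega
      simp only [le_two_mul_iff, ih]
      rcases le_or_gt t m with h | h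
      · obtain ⟨n, rfl⟩ := Nat.exists_eq_add_of_le h
        rw [show t + n + 1 + 1 - (t + 1) = n + 1 by omega, show t + n + 1 - (t + 1) = n by omega,
          show t + n + 1 - t = n + 1 by omega, sum_range_succ_choose_succ]
      · rw [show m + 1 + 1 - (t + 1) = 0 by omega, show m + 1 - (t + 1) = 0 by omega,
          show m + 1 - t = 0 by omega]
        simp

lemma det_kronPow (m : ℕ) : (kronPow m).det = 1 := by
  induction m with
  | zero => simp [kronPow]
  | succ m ih =>
    rw [kronPow_succ, Matrix.det_reindex_self, Matrix.det_kronecker, ih]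
    simp [K2]

lemma linearIndependent_kronPow (m : ℕ) : LinearIndependent (ZMod 2) (kronPow m) :=
  Matrix.linearIndependent_rows_of_isUnit
    ((Matrix.isUnit_iff_isUnit_det _).2 (by simp [det_kronPow]))

/-- For `0 ≤ r ≤ m`, the `F₂`-span of the rows of `K₂^{⊗m}` of Hamming
weight at least `2^{m−r}` (the Reed–Muller code `RM(r, m)`) has dimension
`Σ_{j=0}^{r} C(m, j)`; equivalently, the number of such rows equals `Σ_{j=0}^{r} C(m, j)`,
and these rows are linearly independent. -/
theorem reed_muller_dimension (m r : ℕ) (hr : r ≤ m) :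
    Module.finrank (ZMod 2)
        (Submodule.span (ZMod 2)
          {v : Fin (2 ^ m) → ZMod 2 | ∃ i : Fin (2 ^ m),
            2 ^ (m - r) ≤ (Finset.univ.filter (fun j => kronPow m i j ≠ 0)).card ∧
            v = kronPow m i}) =
      ∑ j ∈ Finset.range (r + 1), m.choose j ∧
    (Finset.univ.filter (fun i : Fin (2 ^ m) =>
        2 ^ (m - r) ≤ (Finset.univ.filter (fun j => kronPow m i j ≠ 0)).card)).card =
      ∑ j ∈ Finset.range (r + 1), m.choose j ∧
    LinearIndependent (ZMod 2)
      (fun i : {i : Fin (2 ^ m) //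
          2 ^ (m - r) ≤ (Finset.univ.filter (fun j => kronPow m i j ≠ 0)).card} =>
        kronPow m i.1) := by
  have card_eq : (Finset.univ.filter (fun i : Fin (2 ^ m) =>
      2 ^ (m - r) ≤ (Finset.univ.filter (fun j => kronPow m i j ≠ 0)).card)).card =
      ∑ j ∈ Finset.range (r + 1), m.choose j := by
    have h := card_two_pow_le_rowWeight m (m - r)
    rwa [show m + 1 - (m - r) = r + 1 by omega] at h
  have indep : LinearIndependent (ZMod 2)
      (fun i : {i : Fin (2 ^ m) //
          2 ^ (m - r) ≤ (Finset.univ.filter (fun j => kronPow m i j ≠ 0)).card} =>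
        kronPow m i.1) :=
    (linearIndependent_kronPow m).comp _ Subtype.val_injective
  refine ⟨?_, card_eq, indep⟩
  rw [← card_eq, ← Fintype.card_subtype, ← finrank_span_eq_card indep]
  refine congrArg (fun s => Module.finrank (ZMod 2) (Submodule.span (ZMod 2) s)) ?_
  ext v
  simp [eq_comm]
end
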